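/- arXiv:2507.01669 — 8 statements merged into one kernel-verified Lean document; each statement's English description precedes it below -/
import Mathlib

section
/- Let n ≥ 0. For every simplex u of the simplicial cube 𝕀^n there exist a permutation π ∈ S_n and a morphism f : [m] → [n] of the simplex category such that u = 𝕀^n(f)(u_π); that is, every simplex of 𝕀^n is a degeneration of a face of some u_π, so the simplices u_π, π ∈ S_n, generate 𝕀^n as a simplicial set. -/
/-- An `m`-simplex of the simplicial cube `𝕀^n`: for each of the `n` coordinates we record
the number of elements of `{0,…,m}` sent to `0` by the corresponding order-preserving map
`{0,…,m} → {0,1}` (a number in `{0,…,m+1}`).  Equivalently, this is the partition form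
`(u_0,…,u_{m+1})`, where coordinate `i` belongs to the part `u_{k_i}`. -/
abbrev CubeSimplex (n m : ℕ) : Type := Fin n → Fin (m + 2)

/-- The face operator `d_j : (𝕀^n)_{m+1} → (𝕀^n)_m`, `0 ≤ j ≤ m+1`. -/
def cubeFace {n m : ℕ} (j : Fin (m + 2)) (u : CubeSimplex n (m + 1)) : CubeSimplex n m :=
  fun i =>
    if h : (u i : ℕ) ≤ (j : ℕ) then ⟨(u i : ℕ), by have := j.isLt; omega⟩
    else ⟨(u i : ℕ) - 1, by have := (u i).isLt; omega⟩

/-- The degeneracy operator `s_j : (𝕀^n)_m → (𝕀^n)_{m+1}` (the index `j` is given as a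
natural number; only `0 ≤ j ≤ m` is geometrically meaningful). -/
def cubeDegen {n m : ℕ} (j : ℕ) (u : CubeSimplex n m) : CubeSimplex n (m + 1) :=
  fun i => if (u i : ℕ) ≤ j then (u i).castSucc else (u i).succ

/-- The action `𝕀^n(f) : (𝕀^n)_{m'} → (𝕀^n)_m` of a morphism `f : [m] → [m']` of the
simplex category on the simplices of `𝕀^n` (precomposition of each coordinate with `f`). -/
def cubeAct {n m m' : ℕ} (f : Fin (m + 1) →o Fin (m' + 1)) (u : CubeSimplex n m') :
    CubeSimplex n m :=
  fun i =>
    ⟨(Finset.univ.filter fun x : Fin (m + 1) => (f x : ℕ) < (u i : ℕ)).card, by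
      have h := Finset.card_filter_le (Finset.univ : Finset (Fin (m + 1)))
        (fun x : Fin (m + 1) => (f x : ℕ) < (u i : ℕ))
      have h2 : (Finset.univ : Finset (Fin (m + 1))).card = m + 1 := by simp
      omega⟩

/-- The non-degenerate `n`-simplex `u_π` of `𝕀^n` attached to a permutation `π ∈ S_n`;
in partition form it is `(∅, {π(1)}, …, {π(n)}, ∅)`: the coordinate with (0-based) index
`i` lies in the part with index `π⁻¹(i) + 1`. -/
def uPerm {n : ℕ} (π : Equiv.Perm (Fin n)) : CubeSimplex n n :=
  fun i => ⟨(π.symm i : ℕ) + 1, by have := (π.symm i).isLt; omega⟩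

/-- For a monotone `v`, the number of indices with value at most `x` is at most `k` exactly when
`x < v k`. -/
theorem Monotone.card_filter_le_le_iff {n : ℕ} {α : Type*} [LinearOrder α] {v : Fin n → α}
    (hv : Monotone v) (x : α) (k : Fin n) :
    (Finset.univ.filter fun j => v j ≤ x).card ≤ (k : ℕ) ↔ x < v k := by
  constructor
  · intro h
    by_contra! hx
    have hsub : Finset.Iic k ⊆ Finset.univ.filter fun j => v j ≤ x := fun j hj => by
      simpa using (hv (Finset.mem_Iic.1 hj)).trans hx
    have := Finset.card_le_card hsub
    rw [Fin.card_Iic] at this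
    omega
  · intro hx
    have hsub : (Finset.univ.filter fun j => v j ≤ x) ⊆ Finset.Iio k := fun j hj => by
      rw [Finset.mem_Iio]
      by_contra! hkj
      exact absurd ((hv hkj).trans (Finset.mem_filter.1 hj).2) (not_le.2 hx)
    simpa using Finset.card_le_card hsub

/-- Every simplex `u` of the simplicial cube `𝕀^n` is a degeneration of a
face of some `u_π`: there are a permutation `π ∈ S_n` and a morphism `f : [m] → [n]` of the
simplex category (an order-preserving map `{0,…,m} → {0,…,n}`) with `u = 𝕀^n(f)(u_π)`.
Hence the simplices `u_π`, `π ∈ S_n`, generate `𝕀^n` as a simplicial set. -/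
theorem szczarba_stmt2 (n m : ℕ) (u : CubeSimplex n m) :
    ∃ (π : Equiv.Perm (Fin n)) (f : Fin (m + 1) →o Fin (n + 1)),
      u = cubeAct f (uPerm π) := by
  let π := Tuple.sort u
  have hmono : Monotone (u ∘ π) := Tuple.monotone_sort u
  let f : Fin (m + 1) →o Fin (n + 1) :=
    { toFun := fun x => ⟨(Finset.univ.filter fun j => (u ∘ π) j ≤ x.castSucc).card,
        Nat.lt_succ_of_le (by
          simpa using Finset.card_filter_le Finset.univ (fun j => (u ∘ π) j ≤ x.castSucc))⟩
      monotone' := fun x y hxy => Finset.card_le_card <|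
        Finset.monotone_filter_right _ fun j _ hj =>
          hj.trans (Fin.castSucc_le_castSucc_iff.2 hxy) }
  refine ⟨π, f, funext fun i => Fin.ext ?_⟩
  have key : ∀ x : Fin (m + 1), (f x : ℕ) < (uPerm π i : ℕ) ↔ (x : ℕ) < (u i : ℕ) := by
    intro x
    have h := hmono.card_filter_le_le_iff x.castSucc (π.symm i)
    rw [Function.comp_apply, Equiv.apply_symm_apply, Fin.lt_def] at h
    exact Nat.lt_succ_iff.trans h
  simp only [cubeAct, key, Fin.card_filter_val_lt]
  have := (u i).isLt
  omega
end

section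
/- Let n ≥ 1 and let π, π' ∈ S_n be distinct permutations. The n-simplices u_π and u_{π'} of the simplicial cube 𝕀^n are adjacent (i.e., they have a common facet: d_i u_π = d_{i'} u_{π'} for some 0 ≤ i, i' ≤ n) if and only if π' = π ∘ (j, j+1) for some adjacent transposition (j, j+1) with 0 < j < n. In this case the j-th facets agree: d_j u_π = d_j u_{π'}. -/
theorem cubeFace_uPerm_val {d : ℕ} (a : Fin (d + 2)) (π : Equiv.Perm (Fin (d + 1)))
    (i : Fin (d + 1)) :
    (cubeFace a (uPerm π) i : ℕ) =
      (π.symm i : ℕ) + if (π.symm i : ℕ) < (a : ℕ) then 1 else 0 := by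
  simp only [cubeFace, uPerm]
  split_ifs <;> grind

/-- The sum of the coordinates of a facet of `u_π` determines which facet it is. -/
theorem sum_cubeFace_uPerm {d : ℕ} (a : Fin (d + 2)) (π : Equiv.Perm (Fin (d + 1))) :
    ∑ i, (cubeFace a (uPerm π) i : ℕ) = (∑ i : Fin (d + 1), (i : ℕ)) + a := by
  simp only [cubeFace_uPerm_val]
  rw [Equiv.sum_comp π.symm fun p : Fin (d + 1) => (p : ℕ) + if (p : ℕ) < (a : ℕ) then 1 else 0,
    Finset.sum_add_distrib, Finset.sum_boole]
  have := a.isLt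
  simp [Fin.card_filter_val_lt]
  omega

/-- A nontrivial permutation that moves no point except possibly between positions `a - 1` and `a`
is an adjacent transposition. -/
theorem exists_eq_swap_of_apply_eq_or {d : ℕ} (a : ℕ) {ρ : Equiv.Perm (Fin (d + 1))} (hρ : ρ ≠ 1)
    (h : ∀ x, ρ x = x ∨ ((ρ x : ℕ) = a ∧ (x : ℕ) + 1 = a) ∨ ((ρ x : ℕ) + 1 = a ∧ (x : ℕ) = a)) :
    ∃ t : Fin d, ρ = Equiv.swap t.castSucc t.succ := by
  obtain ⟨x, hx⟩ : ∃ x, ρ x ≠ x := by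
    by_contra! hfix
    exact hρ (Equiv.ext hfix)
  have hlt := x.isLt
  have hlt' := (ρ x).isLt
  refine ⟨⟨a - 1, by grind⟩, ?_⟩
  ext y
  have hinj := ρ.injective.eq_iff (a := x) (b := y)
  have hx' := h x
  have hy := h y
  rw [Equiv.swap_apply_def]
  simp only [Fin.ext_iff, apply_ite Fin.val, Fin.val_castSucc, Fin.val_succ] at *
  split_ifs <;> omega

theorem exists_eq_mul_swap_of_cubeFace_eq {d : ℕ} {π π' : Equiv.Perm (Fin (d + 1))} (hne : π ≠ π')
    {a b : Fin (d + 2)} (h : cubeFace a (uPerm π) = cubeFace b (uPerm π')) :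
    ∃ t : Fin d, π' = π * Equiv.swap t.castSucc t.succ := by
  have hab : (a : ℕ) = b := by
    have hs := sum_cubeFace_uPerm a π
    rw [h, sum_cubeFace_uPerm] at hs
    omega
  have hρ : π⁻¹ * π' ≠ 1 := fun h1 => hne (inv_mul_eq_one.mp h1)
  obtain ⟨t, ht⟩ := exists_eq_swap_of_apply_eq_or (a : ℕ) hρ fun x => by
    have hx := congrArg Fin.val (congrFun h (π' x))
    rw [cubeFace_uPerm_val, cubeFace_uPerm_val, Equiv.symm_apply_apply, ← hab] at hx
    simp only [Equiv.Perm.mul_apply, Equiv.Perm.inv_def, Fin.ext_iff]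
    split_ifs at hx <;> omega
  exact ⟨t, inv_mul_eq_iff_eq_mul.mp ht⟩

theorem cubeFace_uPerm_mul_swap {d : ℕ} (π : Equiv.Perm (Fin (d + 1))) (t : Fin d) :
    cubeFace t.succ.castSucc (uPerm π) =
      cubeFace t.succ.castSucc (uPerm (π * Equiv.swap t.castSucc t.succ)) := by
  ext i
  have hsymm : (π * Equiv.swap t.castSucc t.succ).symm i =
      Equiv.swap t.castSucc t.succ (π.symm i) := rfl
  rw [cubeFace_uPerm_val, cubeFace_uPerm_val, hsymm, Equiv.swap_apply_def]
  simp only [Fin.ext_iff, Fin.val_castSucc, Fin.val_succ]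
  split_ifs <;> simp_all

/-- Let `n = d+1 ≥ 1` and let `π ≠ π'` in `S_n`.  The `n`-simplices `u_π`
and `u_{π'}` of `𝕀^n` are adjacent (have a common facet `d_a u_π = d_b u_{π'}`) if and only
if `π' = π ∘ (j, j+1)` for an adjacent transposition `(j, j+1)` with `0 < j < n` (below the
1-based transposition `(j, j+1)` with `j = t+1` is the swap of the 0-based positions
`t, t+1`).  In that case the `j`-th facets agree: `d_j u_π = d_j u_{π'}`. -/
theorem szczarba_stmt4 (d : ℕ) (π π' : Equiv.Perm (Fin (d + 1))) (hne : π ≠ π') :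
    ((∃ a b : Fin (d + 2), cubeFace a (uPerm π) = cubeFace b (uPerm π')) ↔
      ∃ t : Fin d, π' = π * Equiv.swap t.castSucc t.succ) ∧
    ∀ t : Fin d, π' = π * Equiv.swap t.castSucc t.succ →
      cubeFace t.succ.castSucc (uPerm π) = cubeFace t.succ.castSucc (uPerm π') := by
  refine ⟨⟨fun ⟨_, _, h⟩ => exists_eq_mul_swap_of_cubeFace_eq hne h, fun ⟨t, ht⟩ => ?_⟩, ?_⟩
  · exact ⟨t.succ.castSucc, t.succ.castSucc, ht ▸ cubeFace_uPerm_mul_swap π t⟩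
  · rintro t rfl
    exact cubeFace_uPerm_mul_swap π t
end

section
/- Let n ≥ 1 and let π ≠ π' ∈ S_n. Let v be a common face of u_π and u_{π'} in 𝕀^n such that every common face of u_π and u_{π'} is a face of v (i.e., v is the intersection u_π ∩ u_{π'}). Then there is a sequence π_0, …, π_l in S_n of length l ≥ 1 such that: (1) π_0 = π and π_l = π'; (2) for every 1 ≤ j ≤ l, the simplices u_{π_{j−1}} and u_{π_j} are adjacent (they have a common facet); and (3) v is a face of u_{π_j} for every 0 ≤ j ≤ l. -/
/-- `v` is a face of `u`: `v = X(f)(u)` for some injective (= strictly monotone) morphism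
`f` of the simplex category. -/
def IsFaceOf {n m M : ℕ} (v : CubeSimplex n m) (u : CubeSimplex n M) : Prop :=
  ∃ f : Fin (m + 1) →o Fin (M + 1), StrictMono f ∧ v = cubeAct f u

theorem cubeAct_uPerm_apply {n m : ℕ} (f : Fin (m + 1) →o Fin (n + 1))
    (σ τ : Equiv.Perm (Fin n)) (k : Fin n) :
    cubeAct f (uPerm σ) (σ k) = cubeAct f (uPerm τ) (τ k) := by
  simp [cubeAct, uPerm]

theorem IsFaceOf.monotone_comp {n m : ℕ} {v : CubeSimplex n m} {σ : Equiv.Perm (Fin n)}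
    (h : IsFaceOf v (uPerm σ)) : Monotone (v ∘ σ) := by
  obtain ⟨f, -, rfl⟩ := h
  intro a b hab
  have hab' : (a : ℕ) ≤ b := hab
  simp only [Function.comp_apply, cubeAct, uPerm, Equiv.symm_apply_apply, Fin.mk_le_mk]
  refine Finset.card_le_card fun x hx => ?_
  simp only [Finset.mem_filter, Finset.mem_univ, true_and] at hx ⊢
  omega

theorem IsFaceOf.of_comp_eq {n m : ℕ} {v : CubeSimplex n m} {σ τ : Equiv.Perm (Fin n)}
    (h : IsFaceOf v (uPerm σ)) (hτ : v ∘ τ = v ∘ σ) : IsFaceOf v (uPerm τ) := by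
  obtain ⟨f, hf, hv⟩ := h
  refine ⟨f, hf, funext fun i => ?_⟩
  obtain ⟨k, rfl⟩ := τ.surjective i
  rw [cubeAct_uPerm_apply f τ σ, ← hv]
  exact congrFun hτ k

theorem cubeFace_uPerm_mul_swap_s5 {d : ℕ} (σ : Equiv.Perm (Fin (d + 1))) (k : Fin d) :
    cubeFace k.succ.castSucc (uPerm σ) =
      cubeFace k.succ.castSucc (uPerm (σ * Equiv.swap k.castSucc k.succ)) := by
  funext i
  obtain ⟨a, rfl⟩ := σ.surjective i
  have hs : (σ * Equiv.swap k.castSucc k.succ).symm (σ a) =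
      Equiv.swap k.castSucc k.succ a := by
    rw [Equiv.symm_apply_eq]
    simp
  simp only [cubeFace, uPerm, hs, Equiv.symm_apply_apply]
  by_cases h1 : a = k.castSucc
  · subst h1
    simp
  by_cases h2 : a = k.succ
  · subst h2
    simp
  simp only [Equiv.swap_apply_of_ne_of_ne h1 h2]

/-- A permutation without descents is the identity. -/
theorem exists_descent_of_ne_one {d : ℕ} {ρ : Equiv.Perm (Fin (d + 1))} (h : ρ ≠ 1) :
    ∃ k : Fin d, ρ k.succ < ρ k.castSucc := by
  by_contra! hcon
  have hmono : StrictMono ρ := Fin.strictMono_iff_lt_succ.2 fun k =>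
    lt_of_le_of_ne (hcon k) (ρ.injective.ne (Fin.castSucc_lt_succ).ne)
  exact h (Equiv.ext fun i => congrFun
    ((StrictMono.range_inj hmono strictMono_id).1 (by simp [ρ.surjective.range_eq])) i)

/-- Two permutations sorting the same function are connected by a sequence of adjacent
transpositions through permutations sorting that function. -/
theorem exists_adjacent_sequence {d : ℕ} {α : Type*} [LinearOrder α] (v : Fin (d + 1) → α)
    (π' : Equiv.Perm (Fin (d + 1))) (hmono : Monotone (v ∘ π')) (π : Equiv.Perm (Fin (d + 1)))
    (hπ : v ∘ π = v ∘ π') :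
    ∃ (l : ℕ) (πs : ℕ → Equiv.Perm (Fin (d + 1))), πs 0 = π ∧ πs l = π' ∧
      (∀ j < l, ∃ k : Fin d, πs (j + 1) = πs j * Equiv.swap k.castSucc k.succ) ∧
      ∀ j ≤ l, v ∘ πs j = v ∘ π' := by
  induction hL : toLex (⇑(π'⁻¹ * π)) using WellFoundedLT.induction generalizing π with
  | ind L ih =>
  subst hL
  by_cases h : π = π'
  · exact ⟨0, fun _ => π, rfl, h, by simp, fun _ _ => hπ⟩
  obtain ⟨k, hk⟩ := exists_descent_of_ne_one (ρ := π'⁻¹ * π)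
    (fun h1 => h (inv_mul_eq_one.1 h1).symm)
  have hval : ∀ i, v (π' ((π'⁻¹ * π) i)) = v (π' i) := fun i => by
    simpa using congrFun hπ i
  have heq : v (π' k.castSucc) = v (π' k.succ) := by
    refine le_antisymm (hmono (Fin.castSucc_lt_succ).le) ?_
    rw [← hval k.castSucc, ← hval k.succ]
    exact hmono hk.le
  have hπ1 : v ∘ ⇑(π * Equiv.swap k.castSucc k.succ) = v ∘ π' := by
    funext i
    have hi := congrFun hπ (Equiv.swap k.castSucc k.succ i)
    simp only [Function.comp_apply, Equiv.Perm.mul_apply] at hi ⊢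
    rw [hi, Equiv.swap_apply_def]
    split_ifs <;> simp_all
  obtain ⟨l, πs, h0, hl, hadj, hface⟩ := ih _
    (Pi.lex_desc (f := ⇑(π'⁻¹ * π)) (Fin.castSucc_lt_succ (i := k)).le hk)
    (π * Equiv.swap k.castSucc k.succ) hπ1 (by rw [← mul_assoc]; rfl)
  refine ⟨l + 1, fun j => Nat.casesOn j π πs, rfl, hl, ?_, ?_⟩
  · rintro (_ | j) hj
    · exact ⟨k, h0⟩
    · exact hadj j (by omega)
  · rintro (_ | j) hj
    · exact hπ
    · exact hface j (by omega)


/-- Let `n = d+1 ≥ 1`, let `π ≠ π'` in `S_n`, and let `v` be a common face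
of `u_π` and `u_{π'}` such that every common face of `u_π` and `u_{π'}` is a face of `v`
(i.e. `v = u_π ∩ u_{π'}`).  Then there is a sequence `π_0, …, π_l` in `S_n`, `l ≥ 1`, with
`π_0 = π`, `π_l = π'`, such that consecutive simplices `u_{π_{j-1}}, u_{π_j}` are adjacent
(share a common facet) and `v` is a face of every `u_{π_j}`. -/
theorem szczarba_stmt5 (d mv : ℕ) (π π' : Equiv.Perm (Fin (d + 1))) (hne : π ≠ π')
    (v : CubeSimplex (d + 1) mv)
    (hv : IsFaceOf v (uPerm π)) (hv' : IsFaceOf v (uPerm π'))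
    (hmax : ∀ (m' : ℕ) (w : CubeSimplex (d + 1) m'),
      IsFaceOf w (uPerm π) → IsFaceOf w (uPerm π') → IsFaceOf w v) :
    ∃ (l : ℕ) (πs : ℕ → Equiv.Perm (Fin (d + 1))),
      1 ≤ l ∧ πs 0 = π ∧ πs l = π' ∧
      (∀ j, 1 ≤ j → j ≤ l → ∃ a b : Fin (d + 2),
        cubeFace a (uPerm (πs (j - 1))) = cubeFace b (uPerm (πs j))) ∧
      (∀ j, j ≤ l → IsFaceOf v (uPerm (πs j))) := by
  have hcomp : v ∘ π = v ∘ π' := Tuple.unique_monotone hv.monotone_comp hv'.monotone_comp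
  obtain ⟨l, πs, h0, hl, hadj, hface⟩ :=
    exists_adjacent_sequence v π' hv'.monotone_comp π hcomp
  refine ⟨l, πs, ?_, h0, hl, ?_, fun j hj => hv'.of_comp_eq (hface j hj)⟩
  · rcases Nat.eq_zero_or_pos l with rfl | h
    · exact absurd (h0.symm.trans hl) hne
    · exact h
  · intro j hj1 hjl
    obtain ⟨j, rfl⟩ := Nat.exists_eq_add_of_le' hj1
    obtain ⟨k, hk⟩ := hadj j hjl
    refine ⟨k.succ.castSucc, k.succ.castSucc, ?_⟩
    rw [hk]
    exact cubeFace_uPerm_mul_swap_s5 (πs j) k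
end

section
/- Let X be a simplicial set, let n ≥ 0, and let (x_π)_{π ∈ S_n} be a family of n-simplices of X. The assignment u_π ↦ x_π for all π ∈ S_n extends to a simplicial map f : 𝕀^n → X if and only if d_j x_π = d_j x_{π∘(j,j+1)} for every π ∈ S_n and every 0 < j < n, where (j, j+1) is the adjacent transposition. Moreover, such an extension f is unique. -/
/-- A simplicial set, presented as a contravariant functor on the skeleton of the simplex
category: `obj m` is the set of `m`-simplices, and a morphism `f : [m] → [m']` (an
order-preserving map `{0,…,m} → {0,…,m'}`) acts by `map f : obj m' → obj m`,
functorially. -/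
structure SSetSkel where
  obj : ℕ → Type
  map : ∀ {m m' : ℕ}, (Fin (m + 1) →o Fin (m' + 1)) → obj m' → obj m
  map_id : ∀ (m : ℕ) (x : obj m), map OrderHom.id x = x
  map_comp : ∀ {a b c : ℕ} (f : Fin (a + 1) →o Fin (b + 1)) (g : Fin (b + 1) →o Fin (c + 1))
    (x : obj c), map (g.comp f) x = map f (map g x)

/-- The coface morphism `δ_j : [n-1] → [n]` of the simplex category (the increasing
injection skipping `j`), inducing the face operator `d_j : obj n → obj (n-1)`.
(Only meaningful for `n ≥ 1`, which always holds where it is used below.) -/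
def dmap (n j : ℕ) : Fin (n - 1 + 1) →o Fin (n + 1) where
  toFun x :=
    if (x : ℕ) < j then ⟨(x : ℕ), by have := x.isLt; omega⟩
    else if h : (x : ℕ) + 1 ≤ n then ⟨(x : ℕ) + 1, by omega⟩
    else ⟨(x : ℕ), by have := x.isLt; omega⟩
  monotone' := by
    intro x y hxy
    have h := (Fin.le_def).mp hxy
    dsimp only
    split_ifs <;> simp only [Fin.mk_le_mk] <;> omega

theorem Equiv.Perm.comp_mul_swap_eq {ι α : Type*} [DecidableEq ι] {v : ι → α} {π : Equiv.Perm ι}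
    {a b : ι} (h : v (π a) = v (π b)) : v ∘ (π * Equiv.swap a b) = v ∘ π := by
  funext k
  simp only [Function.comp_apply, Equiv.Perm.mul_apply]
  by_cases ha : k = a
  · subst ha
    rw [Equiv.swap_apply_left, h]
  by_cases hb : k = b
  · subst hb
    rw [Equiv.swap_apply_right, h]
  rw [Equiv.swap_apply_of_ne_of_ne ha hb]

section AdjacentSwaps

variable {n : ℕ} {α β : Type*} [LinearOrder α] {v : Fin n → α} {p : Equiv.Perm (Fin n) → β}

/-- A function on permutations which is invariant under right multiplication by adjacent
transpositions exchanging equal entries of the sorted tuple `v ∘ π` is invariant under all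
transpositions exchanging equal entries. -/
theorem eq_mul_swap_of_adjacent
    (h : ∀ (π : Equiv.Perm (Fin n)) (k : ℕ) (hk : k + 1 < n), Monotone (v ∘ π) →
      v (π ⟨k, by omega⟩) = v (π ⟨k + 1, hk⟩) →
      p (π * Equiv.swap ⟨k, by omega⟩ ⟨k + 1, hk⟩) = p π)
    (d k : ℕ) (hk : k + d + 1 < n) (π : Equiv.Perm (Fin n)) (hπ : Monotone (v ∘ π))
    (hv : v (π ⟨k, by omega⟩) = v (π ⟨k + d + 1, hk⟩)) :
    p (π * Equiv.swap ⟨k, by omega⟩ ⟨k + d + 1, hk⟩) = p π := by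
  induction d generalizing π with
  | zero => exact h π k hk hπ hv
  | succ d ih =>
    have hlow : v (π ⟨k, by omega⟩) = v (π ⟨k + d + 1, by omega⟩) := by
      apply le_antisymm
      · exact hπ (Fin.mk_le_mk.mpr (by omega))
      · rw [hv]
        exact hπ (Fin.mk_le_mk.mpr (by omega))
    have htop : v (π ⟨k + d + 1, by omega⟩) = v (π ⟨k + d + 1 + 1, hk⟩) := hlow.symm.trans hv
    set a : Fin n := ⟨k, by omega⟩ with ha
    set b : Fin n := ⟨k + d + 1, by omega⟩ with hb
    set c : Fin n := ⟨k + d + 1 + 1, hk⟩ with hc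
    have hconj : Equiv.swap a c = Equiv.swap b c * Equiv.swap a b * Equiv.swap b c := by
      have hab : a ≠ b := by simp [ha, hb]; omega
      have hac : a ≠ c := by simp [ha, hc]; omega
      rw [Equiv.swap_mul_swap_mul_swap hab hac, Equiv.swap_comm]
    have h₁ : v ∘ (π * Equiv.swap b c) = v ∘ π := Equiv.Perm.comp_mul_swap_eq htop
    have e₁ : v ((π * Equiv.swap b c) a) = v ((π * Equiv.swap b c) b) :=
      (congrFun h₁ a).trans (hlow.trans (congrFun h₁ b).symm)
    have h₂ : v ∘ (π * Equiv.swap b c * Equiv.swap a b) = v ∘ π :=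
      (Equiv.Perm.comp_mul_swap_eq e₁).trans h₁
    change p (π * Equiv.swap a c) = p π
    rw [hconj, ← mul_assoc, ← mul_assoc]
    refine (h _ (k + d + 1) hk (h₂ ▸ hπ)
      ((congrFun h₂ b).trans (htop.trans (congrFun h₂ c).symm))).trans ?_
    exact (ih (by omega) _ (h₁ ▸ hπ) e₁).trans (h π (k + d + 1) hk hπ htop)

theorem eq_of_monotone_of_adjacent
    (h : ∀ (π : Equiv.Perm (Fin n)) (k : ℕ) (hk : k + 1 < n), Monotone (v ∘ π) →
      v (π ⟨k, by omega⟩) = v (π ⟨k + 1, hk⟩) →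
      p (π * Equiv.swap ⟨k, by omega⟩ ⟨k + 1, hk⟩) = p π)
    {π σ : Equiv.Perm (Fin n)} (hπ : Monotone (v ∘ π)) (hσ : Monotone (v ∘ σ)) :
    p π = p σ := by
  have hswap (π : Equiv.Perm (Fin n)) (hπ : Monotone (v ∘ π)) (a b : Fin n)
      (hv : v (π a) = v (π b)) : p (π * Equiv.swap a b) = p π := by
    wlog hab : a < b generalizing a b
    · rcases (not_lt.mp hab).eq_or_lt with rfl | hba
      · rw [Equiv.swap_self, ← Equiv.Perm.one_def, mul_one]
      · rw [Equiv.swap_comm]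
        exact this b a hv.symm hba
    obtain ⟨d, hd⟩ := Nat.exists_eq_add_of_lt (Fin.lt_def.mp hab)
    obtain ⟨b, hb⟩ := b
    obtain rfl : b = a + d + 1 := hd
    exact eq_mul_swap_of_adjacent h d a hb π hπ hv
  obtain ⟨τ, rfl⟩ : ∃ τ, σ = π * τ := ⟨π⁻¹ * σ, by simp⟩
  have hτ : v ∘ (π * τ) = v ∘ π := Tuple.unique_monotone hσ hπ
  clear hσ
  induction hc : τ.support.card using Nat.strong_induction_on generalizing τ π with
  | _ c ih =>
    by_cases h1 : τ = 1
    · simp [h1]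
    · obtain ⟨a, ha⟩ : ∃ a, τ a ≠ a := by
        by_contra! hall
        exact h1 (Equiv.ext hall)
      have hva : v (π a) = v (π (τ a)) := (congrFun hτ a).symm
      have hs : v ∘ (π * Equiv.swap a (τ a)) = v ∘ π := Equiv.Perm.comp_mul_swap_eq hva
      have heq : π * τ = π * Equiv.swap a (τ a) * (Equiv.swap a (τ a) * τ) := by
        rw [mul_assoc, Equiv.swap_mul_self_mul]
      rw [heq, ← ih _ (hc ▸ Equiv.Perm.card_support_swap_mul ha) (hs ▸ hπ) _ ?_ rfl,
        hswap π hπ _ _ hva]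
      rw [← heq, hτ, hs]

end AdjacentSwaps

section Cube

variable {n m m' : ℕ}

theorem lt_cubeAct_iff (f : Fin (m + 1) →o Fin (m' + 1)) (u : CubeSimplex n m') (i : Fin n)
    (x : Fin (m + 1)) : (x : ℕ) < cubeAct f u i ↔ (f x : ℕ) < u i := by
  change (x : ℕ) < (Finset.univ.filter fun y : Fin (m + 1) => (f y : ℕ) < (u i : ℕ)).card ↔ _
  constructor
  · intro h
    by_contra! hx
    refine absurd h (not_lt.mpr ((Finset.card_le_card (t := Finset.Iio x) fun y hy => ?_).trans
      (Fin.card_Iio x).le))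
    rw [Finset.mem_filter_univ] at hy
    rw [Finset.mem_Iio]
    by_contra! hxy
    have := Fin.le_def.mp (f.monotone hxy)
    omega
  · intro h
    refine lt_of_lt_of_le (b := (Finset.Iic x).card) (by rw [Fin.card_Iic]; omega)
      (Finset.card_le_card fun y hy => ?_)
    rw [Finset.mem_filter_univ]
    have := Fin.le_def.mp (f.monotone (Finset.mem_Iic.mp hy))
    omega

theorem cubeSimplex_ext {u v : CubeSimplex n m}
    (h : ∀ (i : Fin n) (x : Fin (m + 1)), (x : ℕ) < u i ↔ (x : ℕ) < v i) : u = v := by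
  funext i
  apply Fin.ext
  have hu := (u i).isLt
  have hv := (v i).isLt
  rcases lt_trichotomy (u i : ℕ) (v i) with hlt | heq | hlt
  · exact absurd ((h i ⟨u i, by omega⟩).mpr hlt) (lt_irrefl _)
  · exact heq
  · exact absurd ((h i ⟨v i, by omega⟩).mp hlt) (lt_irrefl _)

/-- The operator `x ↦ #{i | v i ≤ x}`, through which `v` is a simplicial operator applied to
`uPerm π` for every `π` sorting `v`. -/
def cubeRank (v : CubeSimplex n m) : Fin (m + 1) →o Fin (n + 1) where
  toFun x := ⟨(Finset.univ.filter fun i : Fin n => (v i : ℕ) ≤ x).card,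
    Nat.lt_succ_of_le ((Finset.card_filter_le _ _).trans (by simp))⟩
  monotone' x y hxy := by
    rw [Fin.mk_le_mk]
    refine Finset.card_le_card fun i hi => ?_
    rw [Finset.mem_filter_univ] at hi ⊢
    exact hi.trans hxy

theorem cubeRank_le_iff {v : CubeSimplex n m} {π : Equiv.Perm (Fin n)} (hπ : Monotone (v ∘ π))
    (x : Fin (m + 1)) (k : Fin n) : (cubeRank v x : ℕ) ≤ k ↔ (x : ℕ) < v (π k) := by
  have hcard : (cubeRank v x : ℕ) =
      (Finset.univ.filter fun i : Fin n => (v (π i) : ℕ) ≤ x).card := by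
    change (Finset.univ.filter fun i : Fin n => (v i : ℕ) ≤ x).card = _
    exact (Finset.card_equiv π fun i => by
      rw [Finset.mem_filter_univ, Finset.mem_filter_univ]).symm
  rw [hcard]
  constructor
  · intro h
    by_contra! hx
    refine absurd (Finset.card_le_card (s := Finset.Iic k) fun i hi => ?_)
      (not_le.mpr (h.trans_lt (by rw [Fin.card_Iic]; omega)))
    rw [Finset.mem_filter_univ]
    exact le_trans (Fin.le_def.mp (hπ (Finset.mem_Iic.mp hi))) hx
  · intro h
    refine (Finset.card_le_card (t := Finset.Iio k) fun i hi => ?_).trans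
      (by rw [Fin.card_Iio])
    rw [Finset.mem_filter_univ] at hi
    rw [Finset.mem_Iio]
    by_contra! hki
    have := Fin.le_def.mp (hπ hki)
    simp only [Function.comp_apply] at this
    omega

theorem cubeAct_cubeRank_uPerm {v : CubeSimplex n m} {π : Equiv.Perm (Fin n)}
    (hπ : Monotone (v ∘ π)) : cubeAct (cubeRank v) (uPerm π) = v := by
  refine cubeSimplex_ext fun i x => ?_
  have h := cubeRank_le_iff hπ x (π.symm i)
  rw [Equiv.apply_symm_apply] at h
  rw [lt_cubeAct_iff, ← h]
  exact Nat.lt_succ_iff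

theorem cubeRank_cubeAct (f : Fin (m + 1) →o Fin (m' + 1)) (u : CubeSimplex n m') :
    cubeRank (cubeAct f u) = (cubeRank u).comp f := by
  ext x
  change (Finset.univ.filter fun i : Fin n => (cubeAct f u i : ℕ) ≤ x).card =
    (Finset.univ.filter fun i : Fin n => (u i : ℕ) ≤ f x).card
  congr 1
  ext i
  simp only [Finset.mem_filter_univ]
  rw [← not_lt, ← not_lt, lt_cubeAct_iff]

theorem monotone_cubeAct_comp (f : Fin (m + 1) →o Fin (m' + 1)) {u : CubeSimplex n m'}
    {π : Equiv.Perm (Fin n)} (hπ : Monotone (u ∘ π)) : Monotone (cubeAct f u ∘ π) := by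
  intro i j hij
  change (Finset.univ.filter fun x => (f x : ℕ) < u (π i)).card ≤
    (Finset.univ.filter fun x => (f x : ℕ) < u (π j)).card
  refine Finset.card_le_card fun x hx => ?_
  rw [Finset.mem_filter_univ] at hx ⊢
  exact hx.trans_le (Fin.le_def.mp (hπ hij))

theorem monotone_uPerm_comp (π : Equiv.Perm (Fin n)) : Monotone (uPerm π ∘ π) := by
  intro i j hij
  simpa [uPerm] using hij

theorem cubeRank_uPerm (π : Equiv.Perm (Fin n)) : cubeRank (uPerm π) = OrderHom.id := by
  have key (x : Fin (n + 1)) (k : Fin n) : (cubeRank (uPerm π) x : ℕ) ≤ k ↔ (x : ℕ) ≤ k := by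
    rw [cubeRank_le_iff (monotone_uPerm_comp π)]
    simp [uPerm]
  ext x
  have hr := x.isLt
  have hr' := (cubeRank (uPerm π) x).isLt
  change (cubeRank (uPerm π) x : ℕ) = x
  rcases lt_trichotomy (cubeRank (uPerm π) x : ℕ) x with hlt | heq | hlt
  · have := (key x ⟨cubeRank (uPerm π) x, by omega⟩).mp le_rfl
    simp only at this
    omega
  · exact heq
  · have := (key x ⟨x, by omega⟩).mpr le_rfl
    simp only at this
    omega

theorem val_dmap (j : ℕ) (x : Fin (n - 1 + 1)) :
    (dmap n j x : ℕ) = if (x : ℕ) < j then (x : ℕ) else if (x : ℕ) + 1 ≤ n then x + 1 else x := by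
  change Fin.val (ite _ _ (dite _ _ _)) = _
  split_ifs <;> rfl

theorem dmap_apply_ne {j : ℕ} (hjn : j < n) (x : Fin (n - 1 + 1)) : (dmap n j x : ℕ) ≠ j := by
  have := x.isLt
  rw [val_dmap]
  split_ifs <;> omega

/-- An operator omitting the value `j` factors through the coface operator `dmap n j`. -/
theorem exists_eq_dmap_comp {j : ℕ} (hjn : j < n) (f : Fin (m + 1) →o Fin (n + 1))
    (hf : ∀ x, (f x : ℕ) ≠ j) : ∃ g, f = (dmap n j).comp g := by
  let g : Fin (m + 1) →o Fin (n - 1 + 1) :=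
    { toFun x := ⟨if (f x : ℕ) < j then f x else f x - 1, by
        have := (f x).isLt
        split_ifs <;> omega⟩
      monotone' x y hxy := by
        have := Fin.le_def.mp (f.monotone hxy)
        have := hf x
        rw [Fin.mk_le_mk]
        split_ifs <;> omega }
  have hg (x : Fin (m + 1)) : (g x : ℕ) = if (f x : ℕ) < j then (f x : ℕ) else f x - 1 := rfl
  refine ⟨g, ?_⟩
  ext x
  have := hf x
  have := (f x).isLt
  rw [OrderHom.comp_coe, Function.comp_apply, val_dmap, hg]
  split_ifs <;> omega

theorem cubeAct_dmap_uPerm_mul_swap (π : Equiv.Perm (Fin n)) {k : ℕ} (hk : k + 1 < n) :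
    cubeAct (dmap n (k + 1)) (uPerm (π * Equiv.swap ⟨k, by omega⟩ ⟨k + 1, hk⟩)) =
      cubeAct (dmap n (k + 1)) (uPerm π) := by
  refine cubeSimplex_ext fun i x => ?_
  rw [lt_cubeAct_iff, lt_cubeAct_iff]
  have hne := dmap_apply_ne hk x
  have hval : (π * Equiv.swap (⟨k, by omega⟩ : Fin n) ⟨k + 1, hk⟩).symm i =
      Equiv.swap (⟨k, by omega⟩ : Fin n) ⟨k + 1, hk⟩ (π.symm i) := rfl
  simp only [uPerm, hval, Equiv.swap_apply_def, Fin.ext_iff]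
  split_ifs <;> simp only <;> omega

end Cube

/-- Let `X` be a simplicial set, `n ≥ 0`, and `(x_π)_{π ∈ S_n}` a family
of `n`-simplices of `X`.  The assignment `u_π ↦ x_π` extends to a simplicial map
`F : 𝕀^n → X` (a family of maps `(𝕀^n)_m → X_m` commuting with all simplicial operators)
if and only if `d_j x_π = d_j x_{π∘(j,j+1)}` for every `π ∈ S_n` and `0 < j < n`, where
`(j,j+1)` is the 1-based adjacent transposition (swapping the 0-based positions `j-1, j`).
Moreover such an extension is unique. -/
theorem szczarba_stmt6 (n : ℕ) (X : SSetSkel) (x : Equiv.Perm (Fin n) → X.obj n) :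
    ((∃ F : ∀ m, CubeSimplex n m → X.obj m,
        (∀ (m m' : ℕ) (f : Fin (m + 1) →o Fin (m' + 1)) (u : CubeSimplex n m'),
          F m (cubeAct f u) = X.map f (F m' u)) ∧
        (∀ π, F n (uPerm π) = x π)) ↔
      (∀ (π : Equiv.Perm (Fin n)) (j : ℕ) (hj : 0 < j) (hjn : j < n),
        X.map (dmap n j) (x π) =
          X.map (dmap n j) (x (π * Equiv.swap ⟨j - 1, by omega⟩ ⟨j, by omega⟩)))) ∧
    (∀ F F' : ∀ m, CubeSimplex n m → X.obj m,
      (∀ (m m' : ℕ) (f : Fin (m + 1) →o Fin (m' + 1)) (u : CubeSimplex n m'),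
        F m (cubeAct f u) = X.map f (F m' u)) →
      (∀ (m m' : ℕ) (f : Fin (m + 1) →o Fin (m' + 1)) (u : CubeSimplex n m'),
        F' m (cubeAct f u) = X.map f (F' m' u)) →
      (∀ π, F n (uPerm π) = x π) → (∀ π, F' n (uPerm π) = x π) →
      F = F') := by
  constructor
  · constructor
    · rintro ⟨F, hF, hx⟩ π j hj hjn
      obtain ⟨k, rfl⟩ := Nat.exists_eq_add_one.mpr hj
      rw [← hx, ← hx, ← hF, ← hF]
      exact congrArg _ (cubeAct_dmap_uPerm_mul_swap π hjn).symm
    · intro h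
      have hwd {m : ℕ} (v : CubeSimplex n m) {π σ : Equiv.Perm (Fin n)}
          (hπ : Monotone (v ∘ π)) (hσ : Monotone (v ∘ σ)) :
          X.map (cubeRank v) (x π) = X.map (cubeRank v) (x σ) := by
        refine eq_of_monotone_of_adjacent (p := fun π => X.map (cubeRank v) (x π))
          (fun π k hk hπ hv => ?_) hπ hσ
        obtain ⟨g, hg⟩ := exists_eq_dmap_comp hk (cubeRank v) fun y hy => by
          have h₁ := cubeRank_le_iff hπ y ⟨k, by omega⟩
          have h₂ := cubeRank_le_iff hπ y ⟨k + 1, hk⟩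
          rw [hv, ← h₂] at h₁
          simp only [hy] at h₁
          omega
        simp only [hg, X.map_comp]
        exact congrArg _ (h π (k + 1) k.succ_pos hk).symm
      refine ⟨fun m v => X.map (cubeRank v) (x (Tuple.sort v)), fun m m' f u => ?_, fun π => ?_⟩
      · beta_reduce
        rw [hwd (cubeAct f u) (Tuple.monotone_sort _)
          (monotone_cubeAct_comp f (Tuple.monotone_sort u)), cubeRank_cubeAct, X.map_comp]
      · change X.map (cubeRank (uPerm π)) (x (Tuple.sort (uPerm π))) = x π
        rw [hwd (uPerm π) (Tuple.monotone_sort _) (monotone_uPerm_comp π), cubeRank_uPerm,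
          X.map_id]
  · intro F F' hF hF' hx hx'
    funext m v
    rw [← cubeAct_cubeRank_uPerm (Tuple.monotone_sort v), hF, hF', hx, hx']
end

section
/- Let k, l ≥ 0 and suppose the permutation π ∈ S_{k+l} corresponds to the (k,l)-shuffle (α,β) and the permutations σ ∈ S_k, τ ∈ S_l under the bijection Ψ_{k,l}, i.e., π = Ψ_{k,l}((α,β),σ,τ). Then under the canonical isomorphism 𝕀^{k+l} ≅ 𝕀^k × 𝕀^l, the (k+l)-simplex u_π corresponds to the pair (v, w), where v = s_{β_l−1}⋯s_{β_1−1} u_σ ∈ 𝕀^k and w = s_{α_k−1}⋯s_{α_1−1} u_τ ∈ 𝕀^l. -/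
/-- A `(k,l)`-shuffle: a pair `(α,β)` of strictly increasing sequences partitioning
`{1,…,k+l}` (represented 0-based as `Fin (k+l)`). -/
structure Shuffle (k l : ℕ) where
  α : Fin k → Fin (k + l)
  β : Fin l → Fin (k + l)
  monoα : StrictMono α
  monoβ : StrictMono β
  disjoint : ∀ a b, α a ≠ β b
  cover : ∀ x, (∃ a, α a = x) ∨ (∃ b, β b = x)

/-- The concatenation `σ ⊔ τ ∈ S_{k+l}` of permutations `σ ∈ S_k` and `τ ∈ S_l`,
acting as `σ` on the first `k` letters and as the shift of `τ` on the last `l` letters. -/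
def permConcat {k l : ℕ} (σ : Equiv.Perm (Fin k)) (τ : Equiv.Perm (Fin l)) :
    Equiv.Perm (Fin (k + l)) :=
  finSumFinEquiv.symm.trans ((Equiv.sumCongr σ τ).trans finSumFinEquiv)

/-- The iterated degeneracy `s_{b(l-1)} ∘ ⋯ ∘ s_{b(1)} ∘ s_{b(0)}`. -/
def multiDegen {n m : ℕ} : ∀ (l : ℕ), (Fin l → ℕ) → CubeSimplex n m → CubeSimplex n (m + l)
  | 0, _, u => u
  | l + 1, b, u => cubeDegen (b (Fin.last l)) (multiDegen l (fun t => b t.castSucc) u)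

open Finset in
/-- A strictly increasing iterated degeneracy moves the coordinate value `p + 1` to `q + 1`, where
`q` is the `p`-th natural number not among the indices. -/
theorem multiDegen_apply_of_notMem {n m : ℕ} (u : CubeSimplex n m) (i : Fin n) :
    ∀ (l : ℕ) (b : Fin l → ℕ), StrictMono b → ∀ p q : ℕ, (u i : ℕ) = p + 1 →
      (∀ t, b t ≠ q) → p + #{t | b t < q} = q → (multiDegen l b u i : ℕ) = q + 1
  | 0, b, _, p, q, hu, _, hc => by
    simp at hc
    simp [multiDegen, hu, hc]
  | l + 1, b, hb, p, q, hu, hq, hc => by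
    have hb' : StrictMono fun t : Fin l => b t.castSucc :=
      hb.comp (Fin.strictMono_castSucc)
    have hlt (t : Fin l) : b t.castSucc < b (Fin.last l) := hb (Fin.castSucc_lt_last t)
    have ih := multiDegen_apply_of_notMem u i l _ hb' p
    rw [card_filter, Fin.sum_univ_castSucc, ← card_filter] at hc
    rcases lt_or_gt_of_ne (hq (Fin.last l)) with h | h
    · have hall : #{t : Fin l | b t.castSucc < q - 1} = l := by
        rw [filter_true_of_mem fun t _ => by have := hlt t; omega]
        simp
      have hall' : #{t : Fin l | b t.castSucc < q} = l := by
        rw [filter_true_of_mem fun t _ => by have := hlt t; omega]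
        simp
      rw [hall', if_pos h] at hc
      have := ih (q - 1) hu (fun t => by have := hlt t; omega) (by rw [hall]; omega)
      simp only [multiDegen, cubeDegen]
      rw [if_neg (by omega), Fin.val_succ]
      omega
    · rw [if_neg (not_lt_of_gt h), add_zero] at hc
      have := ih q hu (fun t => hq _) hc
      simp only [multiDegen, cubeDegen]
      rw [if_pos (by omega), Fin.val_castSucc, this]

open Finset in
/-- If two strictly increasing sequences partition `Fin N`, then the value `α p` exceeds `p` by the
number of values of `β` below it. -/
theorem add_card_filter_lt_of_partition {k l N : ℕ} {α : Fin k → Fin N} {β : Fin l → Fin N}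
    (hα : StrictMono α) (hβ : StrictMono β) (disj : ∀ a b, α a ≠ β b)
    (cover : ∀ x, (∃ a, α a = x) ∨ (∃ b, β b = x)) (p : Fin k) :
    (p : ℕ) + #{t | (β t : ℕ) < α p} = α p := by
  have hunion : Iio (α p) = (Iio p).image α ∪ ({t | β t < α p} : Finset (Fin l)).image β := by
    ext x
    rcases cover x with ⟨a, rfl⟩ | ⟨b, rfl⟩
    · simp [hα.lt_iff_lt, hα.injective.eq_iff, fun a b => (disj a b).symm]
    · simp [hβ.injective.eq_iff, disj]
  have hdisj : Disjoint ((Iio p).image α) (({t | β t < α p} : Finset (Fin l)).image β) := by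
    simp only [disjoint_left, mem_image]
    rintro _ ⟨a, -, rfl⟩ ⟨b, -, h⟩
    exact disj a b h.symm
  have h := congrArg card hunion
  rw [card_union_of_disjoint hdisj, card_image_of_injective _ hα.injective,
    card_image_of_injective _ hβ.injective, Fin.card_Iio, Fin.card_Iio] at h
  simpa using h.symm

/-- Degenerating `u_σ` along a sequence `β` complementary to `α` places the coordinate `σ p` in the
part with index `α p + 1`. -/
theorem multiDegen_uPerm_apply {k l N : ℕ} {α : Fin k → Fin N} {β : Fin l → Fin N}
    (hα : StrictMono α) (hβ : StrictMono β) (disj : ∀ a b, α a ≠ β b)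
    (cover : ∀ x, (∃ a, α a = x) ∨ (∃ b, β b = x)) (σ : Equiv.Perm (Fin k)) (p : Fin k) :
    (multiDegen l (fun b => (β b : ℕ)) (uPerm σ) (σ p) : ℕ) = α p + 1 :=
  multiDegen_apply_of_notMem _ _ _ _ hβ p _ (by simp [uPerm])
    (fun t h => disj p t (Fin.ext h.symm))
    (add_card_filter_lt_of_partition hα hβ disj cover p)

/-- Let `k, l ≥ 0` and let `π ∈ S_{k+l}` correspond to
`((α,β), σ, τ) ∈ Shuff(k,l) × S_k × S_l` under the bijection `Ψ_{k,l}`, i.e.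
`π = (σ ⊔ τ) ∘ π_{α,β}` (hypothesis `hπ`, stated via the inverse of `π_{α,β}`).
Then under the canonical isomorphism `𝕀^{k+l} ≅ 𝕀^k × 𝕀^l` (componentwise: the first `k`
and the last `l` coordinates), the `(k+l)`-simplex `u_π` corresponds to the pair `(v, w)`
with `v = s_{β_l−1}⋯s_{β_1−1} u_σ ∈ 𝕀^k` and `w = s_{α_k−1}⋯s_{α_1−1} u_τ ∈ 𝕀^l`
(the 0-based degeneracy indices being the 0-based values of `β` resp. `α`). -/
theorem szczarba_stmt7 (k l : ℕ) (sh : Shuffle k l)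
    (σ : Equiv.Perm (Fin k)) (τ : Equiv.Perm (Fin l)) (π : Equiv.Perm (Fin (k + l)))
    (hπ : ∀ x : Fin (k + l),
      π (Sum.elim sh.α sh.β (finSumFinEquiv.symm x)) = permConcat σ τ x) :
    (∀ a : Fin k, (uPerm π (Fin.castAdd l a) : ℕ) =
      (multiDegen l (fun b => (sh.β b : ℕ)) (uPerm σ) a : ℕ)) ∧
    (∀ b : Fin l, (uPerm π (Fin.natAdd k b) : ℕ) =
      (multiDegen k (fun a => (sh.α a : ℕ)) (uPerm τ) b : ℕ)) := by
  constructor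
  · intro a
    obtain ⟨p, rfl⟩ := σ.surjective a
    have h := hπ (Fin.castAdd l p)
    simp only [finSumFinEquiv_symm_apply_castAdd, Sum.elim_inl, permConcat, Equiv.trans_apply,
      Equiv.sumCongr_apply, Sum.map_inl, finSumFinEquiv_apply_left] at h
    rw [multiDegen_uPerm_apply sh.monoα sh.monoβ sh.disjoint sh.cover, ← h]
    simp [uPerm]
  · intro b
    obtain ⟨p, rfl⟩ := τ.surjective b
    have h := hπ (Fin.natAdd k p)
    simp only [finSumFinEquiv_symm_apply_natAdd, Sum.elim_inr, permConcat, Equiv.trans_apply,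
      Equiv.sumCongr_apply, Sum.map_inr, finSumFinEquiv_apply_right] at h
    rw [multiDegen_uPerm_apply sh.monoβ sh.monoα (fun b a => (sh.disjoint a b).symm)
      (fun x => (sh.cover x).symm), ← h]
    simp [uPerm]
end

section
/- Let n ≥ 0, π ∈ S_{n+1} and 1 ≤ i ≤ n+1. Set j = π^{-1}(i), and let π̃ ∈ S_n be obtained from π by removing the assignment j ↦ π(j) = i. Then s_{j−1} u_{π̃} = (σ_i)_* u_π in 𝕀^n. -/
/-- `IsRemoval π i πt` says that `πt ∈ S_n` is obtained from `π ∈ S_{n+1}` by removing the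
assignment `i ↦ π(i)` (everything 0-based): remaining entries are renumbered, preserving
the mappings between them. -/
def IsRemoval {n : ℕ} (π : Equiv.Perm (Fin (n + 1))) (i : Fin (n + 1))
    (πt : Equiv.Perm (Fin n)) : Prop :=
  ∀ j : Fin n,
    (πt j : ℕ) =
      if (j : ℕ) < (i : ℕ) then
        (if (π j.castSucc : ℕ) < (π i : ℕ) then (π j.castSucc : ℕ) else (π j.castSucc : ℕ) - 1)
      else
        (if (π j.succ : ℕ) < (π i : ℕ) then (π j.succ : ℕ) else (π j.succ : ℕ) - 1)

/-- The simplicial map `(σ_i)_* : 𝕀^{n+1} → 𝕀^n` deleting the `i`-th coordinate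
(0-based). -/
def sigmaStar {n m : ℕ} (i : Fin (n + 1)) (u : CubeSimplex (n + 1) m) : CubeSimplex n m :=
  fun x => if (x : ℕ) < (i : ℕ) then u x.castSucc else u x.succ

/-- Removing the assignment `i ↦ π i` from `π` conjugates `π` by the order embeddings that
skip `i` and `π i`. -/
theorem IsRemoval.succAbove_apply {n : ℕ} {π : Equiv.Perm (Fin (n + 1))} {i : Fin (n + 1)}
    {πt : Equiv.Perm (Fin n)} (h : IsRemoval π i πt) (j : Fin n) :
    π (i.succAbove j) = (π i).succAbove (πt j) := by
  have hj := h j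
  have hne : (π (i.succAbove j) : ℕ) ≠ (π i : ℕ) := fun e =>
    Fin.succAbove_ne i j (π.injective (Fin.ext e))
  apply Fin.ext
  simp only [Fin.succAbove, Fin.lt_def, Fin.val_castSucc] at hne ⊢
  split_ifs at hj hne ⊢ <;> simp only [Fin.val_castSucc, Fin.val_succ] <;> omega

theorem sigmaStar_apply {n m : ℕ} (i : Fin (n + 1)) (u : CubeSimplex (n + 1) m) (x : Fin n) :
    sigmaStar i u x = u (i.succAbove x) := by
  simp only [sigmaStar, Fin.succAbove, Fin.lt_def, Fin.val_castSucc]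
  split_ifs <;> rfl

/-- Let `n ≥ 0`, `π ∈ S_{n+1}` and `1 ≤ i ≤ n+1`.  Set `j = π⁻¹(i)`,
and let `π̃ ∈ S_n` be obtained from `π` by removing the assignment `j ↦ π(j) = i`.
Then `s_{j-1} u_{π̃} = (σ_i)_* u_π` in `𝕀^n` (0-based: the degeneracy index `j - 1` is the
0-based position `π⁻¹(i)`). -/
theorem szczarba_stmt10 (n : ℕ) (π : Equiv.Perm (Fin (n + 1))) (i : Fin (n + 1))
    (πt : Equiv.Perm (Fin n)) (hrem : IsRemoval π (π.symm i) πt) :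
    cubeDegen ((π.symm i : ℕ)) (uPerm πt) = sigmaStar i (uPerm π) := by
  funext x
  obtain ⟨j, rfl⟩ := πt.surjective x
  have h := hrem.succAbove_apply j
  rw [Equiv.apply_symm_apply] at h
  rw [sigmaStar_apply, ← h]
  apply Fin.ext
  simp only [cubeDegen, uPerm, Equiv.symm_apply_apply, Fin.succAbove, Fin.lt_def,
    Fin.val_castSucc]
  split_ifs <;> simp only [Fin.val_castSucc, Fin.val_succ] <;> omega
end

section
/- Let n ≥ 1 and let 𝐢 = (i_1,…,i_n) ∈ 𝐒_n be such that i_k > i_{k+1} for some 1 ≤ k < n. Then for the adjacent transposition τ = (k, k+1) one has p(𝐢) ∘ τ = p(i_1,…,i_{k−1}, i_{k+1}, i_k − 1, i_{k+2},…,i_n). -/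
/-- `𝐒_n = [n-1] × [n-2] × ⋯ × [0]`: the sequences `(i_1,…,i_n)` with `0 ≤ i_k ≤ n-k`. -/
abbrev SzIndex (n : ℕ) := ∀ k : Fin n, Fin (n - (k : ℕ))

/-- The tail `(i_2,…,i_n)` of a sequence `(i_1,…,i_n) ∈ 𝐒_n`. -/
def szTail {n : ℕ} (i : SzIndex (n + 1)) : SzIndex n :=
  fun k => Fin.cast (Nat.succ_sub_succ n k) (i k.succ)

/-- The permutation of `Fin (n+1)` sending `0` to `v` and `j+1` to `e(j)`, where values
`≥ v` are shifted up by one (i.e. obtained from `e` by adding the assignment `0 ↦ v`). -/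
def insertPerm {n : ℕ} (v : Fin (n + 1)) (e : Equiv.Perm (Fin n)) :
    Equiv.Perm (Fin (n + 1)) :=
  (finSuccEquiv n).trans ((Equiv.optionCongr e).trans (finSuccEquiv' v).symm)

/-- The map `p : 𝐒_n → S_n`, defined recursively by `π(1) = i_1 + 1` and
`π(k) = π'(k-1)` resp. `π'(k-1) + 1` according to whether `π'(k-1) ≤ i_1`,
where `π' = p(i_2,…,i_n)` (here realized 0-based on `Fin n`). -/
def pMap : ∀ n : ℕ, SzIndex n → Equiv.Perm (Fin n)
  | 0, _ => 1
  | n + 1, i => insertPerm (i ⟨0, Nat.succ_pos n⟩) (pMap n (szTail i))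

theorem insertPerm_zero {n : ℕ} (v : Fin (n + 1)) (e : Equiv.Perm (Fin n)) :
    insertPerm v e 0 = v := by
  simp [insertPerm]

theorem insertPerm_succ {n : ℕ} (v : Fin (n + 1)) (e : Equiv.Perm (Fin n)) (k : Fin n) :
    insertPerm v e k.succ = v.succAbove (e k) := by
  simp [insertPerm]

theorem insertPerm_mul_swap_succ {n : ℕ} (v : Fin (n + 1)) (e : Equiv.Perm (Fin n))
    (a b : Fin n) :
    insertPerm v e * Equiv.swap a.succ b.succ = insertPerm v (e * Equiv.swap a b) := by
  ext s
  refine Fin.cases ?_ (fun k => ?_) s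
  · rw [Equiv.Perm.mul_apply, Equiv.swap_apply_of_ne_of_ne (Fin.succ_ne_zero a).symm
      (Fin.succ_ne_zero b).symm, insertPerm_zero, insertPerm_zero]
  · rw [Equiv.Perm.mul_apply, ← (Fin.succ_injective n).map_swap, insertPerm_succ,
      insertPerm_succ, Equiv.Perm.mul_apply]

/-- Exchanging the first two insertions: inserting `w < v` after `v` is the same, up to
the swap of positions `0` and `1`, as inserting `v - 1` after `w`. -/
theorem insertPerm_insertPerm_mul_swap {n : ℕ} (v v' : Fin (n + 2)) (w w' : Fin (n + 1))
    (e : Equiv.Perm (Fin n)) (hlt : (w : ℕ) < v) (hv : (v' : ℕ) = w) (hw : (w' : ℕ) = v - 1) :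
    insertPerm v (insertPerm w e) * Equiv.swap 0 (Fin.succ 0) =
      insertPerm v' (insertPerm w' e) := by
  ext s
  rw [Equiv.Perm.mul_apply]
  refine Fin.cases ?_ (fun k => Fin.cases ?_ (fun l => ?_) k) s
  · rw [Equiv.swap_apply_left, insertPerm_succ, insertPerm_zero, insertPerm_zero]
    simp only [Fin.succAbove, Fin.lt_def, Fin.val_castSucc]
    rw [if_pos hlt, Fin.val_castSucc, hv]
  · rw [Equiv.swap_apply_right, insertPerm_succ, insertPerm_zero, insertPerm_zero]
    simp only [Fin.succAbove, Fin.lt_def, Fin.val_castSucc]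
    rw [if_neg (by omega), Fin.val_succ]
    omega
  · rw [Equiv.swap_apply_of_ne_of_ne (Fin.succ_ne_zero _)
      (fun h => Fin.succ_ne_zero l (Fin.succ_injective _ h))]
    simp only [insertPerm_succ, Fin.succAbove, Fin.lt_def, Fin.val_castSucc]
    split_ifs <;> simp only [Fin.val_castSucc, Fin.val_succ] at * <;> omega

theorem pMap_succ (n : ℕ) (i : SzIndex (n + 1)) :
    pMap (n + 1) i = insertPerm (i 0) (pMap n (szTail i)) :=
  rfl

theorem pMap_mul_swap (m : ℕ) (i j : SzIndex (m + 1)) (t : Fin m)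
    (hlt : (i t.succ : ℕ) < i t.castSucc) (hl : (j t.castSucc : ℕ) = i t.succ)
    (hr : (j t.succ : ℕ) = i t.castSucc - 1)
    (hne : ∀ s : Fin (m + 1), s ≠ t.castSucc → s ≠ t.succ → (j s : ℕ) = i s) :
    pMap (m + 1) i * Equiv.swap t.castSucc t.succ = pMap (m + 1) j := by
  induction m with
  | zero => exact t.elim0
  | succ m ih =>
    induction t using Fin.cases with
    | zero =>
      have htail : szTail (szTail j) = szTail (szTail i) := by
        funext k
        apply Fin.ext
        exact hne k.succ.succ (Fin.succ_ne_zero _)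
          (fun h => Fin.succ_ne_zero k (Fin.succ_injective _ h))
      simp only [pMap, htail]
      exact insertPerm_insertPerm_mul_swap _ _ _ _ _ hlt hl hr
    | succ t =>
      have hzero : j 0 = i 0 :=
        Fin.ext (hne 0 (Fin.succ_ne_zero t.castSucc).symm (Fin.succ_ne_zero _).symm)
      have htail := ih (szTail i) (szTail j) t hlt hl hr (fun s h₁ h₂ =>
        hne s.succ (fun h => h₁ (Fin.succ_injective _ h))
          (fun h => h₂ (Fin.succ_injective _ h)))
      rw [pMap_succ _ i, pMap_succ _ j, ← htail, hzero]
      exact insertPerm_mul_swap_succ _ _ t.castSucc t.succ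

/-- Let `n = m+1 ≥ 1` and let `𝐢 = (i_1,…,i_n) ∈ 𝐒_n` satisfy
`i_k > i_{k+1}` for some `1 ≤ k < n` (1-based `k = t+1` with `t : Fin m`).  Then for the
adjacent transposition `τ = (k, k+1)` (swapping the 0-based positions `t, t+1`) one has
`p(𝐢) ∘ τ = p(i_1,…,i_{k-1}, i_{k+1}, i_k − 1, i_{k+2},…,i_n)`. -/
theorem szczarba_stmt15 (m : ℕ) (i : SzIndex (m + 1)) (t : Fin m)
    (h : (i t.succ : ℕ) < (i t.castSucc : ℕ)) :
    pMap (m + 1) i * Equiv.swap t.castSucc t.succ =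
      pMap (m + 1) (fun s =>
        if h1 : (s : ℕ) = (t : ℕ) then
          ⟨(i t.succ : ℕ), by
            have h2 : ((i t.succ : Fin (m + 1 - ((t : ℕ) + 1))) : ℕ) < m + 1 - ((t : ℕ) + 1) :=
              (i t.succ).isLt
            omega⟩
        else if h2 : (s : ℕ) = (t : ℕ) + 1 then
          ⟨(i t.castSucc : ℕ) - 1, by
            have h3 : ((i t.castSucc : Fin (m + 1 - (t : ℕ))) : ℕ) < m + 1 - (t : ℕ) :=
              (i t.castSucc).isLt
            omega⟩
        else i s) := by
  refine pMap_mul_swap m i _ t h (by simp) (by simp) (fun s h₁ h₂ => ?_)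
  have h₁' : (s : ℕ) ≠ t := fun e => h₁ (Fin.ext e)
  have h₂' : (s : ℕ) ≠ t + 1 := fun e => h₂ (Fin.ext e)
  simp [h₁', h₂']
end

section
/- Let n ≥ 1 and 𝐢 ∈ 𝐒_n, write π = p(𝐢) ∈ S_n, and set (𝐣, q) = Φ(𝐢, 0). Then q + 1 = π^{-1}(1), and p(𝐣) ∈ S_{n−1} is obtained from π by removing the assignment q+1 ↦ 1. -/
/-- Prepending a value to a sequence in `𝐒_n` (the value is clamped into the valid range
`[0, n]`, which is irrelevant for the in-range uses below). -/
def szCons {n : ℕ} (v : ℕ) (i : SzIndex n) : SzIndex (n + 1) := fun k =>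
  match k with
  | ⟨0, _⟩ => ⟨min v n, by
      show min v n < n + 1 - 0
      have := Nat.min_le_right v n; omega⟩
  | ⟨t + 1, ht⟩ =>
    ⟨((i ⟨t, by omega⟩ : Fin (n - t)) : ℕ), by
      have h1 : ((i ⟨t, by omega⟩ : Fin (n - t)) : ℕ) < n - t := (i ⟨t, by omega⟩).isLt
      show ((i ⟨t, by omega⟩ : Fin (n - t)) : ℕ) < n + 1 - (t + 1)
      omega⟩

/-- The map `Φ : 𝐒_{n+1} × [n+1] → 𝐒_n × [n]`, defined recursively on
`𝐢 = (i_1, 𝐢')`: if `r < i_1` then `Φ(𝐢, r) = ((i_1−1, 𝐣'), q'+1)` with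
`(𝐣', q') = Φ(𝐢', r)`; if `r ∈ {i_1, i_1+1}` then `Φ(𝐢, r) = (𝐢', 0)`;
if `r > i_1+1` then `Φ(𝐢, r) = ((i_1, 𝐣'), q'+1)` with `(𝐣', q') = Φ(𝐢', r−1)`.
(The second argument and the `[n]`-component are given as natural numbers.) -/
def Phi : ∀ (n : ℕ), SzIndex (n + 1) → ℕ → SzIndex n × ℕ
  | 0, _, _ => (fun k => k.elim0, 0)
  | n + 1, i, r =>
    let i1 : ℕ := (i ⟨0, Nat.succ_pos _⟩ : ℕ)
    if r < i1 then
      let p := Phi n (szTail i) r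
      (szCons (i1 - 1) p.1, p.2 + 1)
    else if r ≤ i1 + 1 then (szTail i, 0)
    else
      let p := Phi n (szTail i) (r - 1)
      (szCons i1 p.1, p.2 + 1)

theorem val_insertPerm_zero {n : ℕ} (v : Fin (n + 1)) (e : Equiv.Perm (Fin n)) :
    (insertPerm v e 0 : ℕ) = v := by
  simp [insertPerm]

theorem val_insertPerm_succ {n : ℕ} (v : Fin (n + 1)) (e : Equiv.Perm (Fin n)) (j : Fin n) :
    (insertPerm v e j.succ : ℕ) = if (e j : ℕ) < v then (e j : ℕ) else (e j : ℕ) + 1 := by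
  simp only [insertPerm, Equiv.trans_apply, finSuccEquiv_succ, Equiv.optionCongr_apply,
    Option.map_some, finSuccEquiv'_symm_some, Fin.succAbove, Fin.lt_def, Fin.val_castSucc]
  split_ifs <;> rfl

theorem szTail_szCons {n : ℕ} (v : ℕ) (i : SzIndex n) : szTail (szCons v i) = i := by
  funext k
  rfl

/-- Inserting a nonzero first value commutes with removing the assignment whose value is `0`. -/
theorem IsRemoval.insertPerm {n : ℕ} {π : Equiv.Perm (Fin (n + 1))} {q : Fin (n + 1)}
    {πt : Equiv.Perm (Fin n)} (h : IsRemoval π q πt) (hq : π q = 0)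
    {v : Fin (n + 2)} {w : Fin (n + 1)} (hv : (v : ℕ) = w + 1) :
    IsRemoval (_root_.insertPerm v π) q.succ (_root_.insertPerm w πt) := by
  have hq0 : (_root_.insertPerm v π q.succ : ℕ) = 0 := by
    rw [val_insertPerm_succ, hq]
    simp [hv]
  intro j
  rw [hq0]
  cases j using Fin.cases with
  | zero =>
    rw [val_insertPerm_zero, Fin.castSucc_zero, val_insertPerm_zero]
    simp [hv]
  | succ k =>
    have hk := h k
    have hne : ∀ x, x ≠ q → (π x : ℕ) ≠ 0 := fun x hx h0 =>
      hx (π.injective (by rw [hq]; exact Fin.ext h0))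
    have h1 : (k : ℕ) < q → (π k.castSucc : ℕ) ≠ 0 := fun hlt =>
      hne _ (fun e => by simp [← e] at hlt)
    have h2 : ¬ (k : ℕ) < q → (π k.succ : ℕ) ≠ 0 := fun hlt =>
      hne _ (fun e => by simp [← e] at hlt)
    rw [hq] at hk
    rw [← Fin.succ_castSucc]
    simp only [val_insertPerm_succ, Fin.val_succ, Fin.val_zero, Nat.not_lt_zero, if_false,
      Nat.add_lt_add_iff_right] at hk ⊢
    split_ifs at hk ⊢ <;> grind

/-- Removing the first assignment of `insertPerm 0 e` gives back `e`. -/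
theorem isRemoval_insertPerm_zero {n : ℕ} {v : Fin (n + 1)} (hv : (v : ℕ) = 0)
    (e : Equiv.Perm (Fin n)) : IsRemoval (insertPerm v e) 0 e := by
  intro j
  simp [val_insertPerm_zero, val_insertPerm_succ, hv]

theorem Phi_zero_spec (n : ℕ) (i : SzIndex (n + 1)) :
    ∃ q : Fin (n + 1), (Phi n i 0).2 = q ∧ pMap (n + 1) i q = 0 ∧
      IsRemoval (pMap (n + 1) i) q (pMap n (Phi n i 0).1) := by
  induction n with
  | zero => exact ⟨0, rfl, Fin.ext (by omega), fun j => j.elim0⟩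
  | succ n ih =>
    by_cases hi : 0 < (i ⟨0, Nat.succ_pos _⟩ : ℕ)
    · obtain ⟨q, h1, h2, h3⟩ := ih (szTail i)
      have hlt := (i ⟨0, Nat.succ_pos _⟩).isLt
      rw [Phi]
      simp only [hi, if_true]
      refine ⟨q.succ, by simp [h1], ?_, ?_⟩
      · apply Fin.ext
        rw [pMap, val_insertPerm_succ, h2]
        simpa using hi.ne'
      · rw [pMap, pMap.eq_2 n (szCons _ _), szTail_szCons]
        refine h3.insertPerm h2 ?_
        change _ = min _ n + 1
        dsimp only at hlt
        omega
    · have h0 : (i ⟨0, Nat.succ_pos _⟩ : ℕ) = 0 := by omega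
      rw [Phi]
      simp only [hi, if_false, Nat.zero_le, if_true]
      refine ⟨0, rfl, ?_, isRemoval_insertPerm_zero h0 _⟩
      apply Fin.ext
      rw [pMap, val_insertPerm_zero]
      exact h0

/-- Let `n+1 ≥ 1`, `𝐢 ∈ 𝐒_{n+1}`, `π = p(𝐢) ∈ S_{n+1}`, and set
`(𝐣, q) = Φ(𝐢, 0)`.  Then `q + 1 = π⁻¹(1)` (0-based: `q` is the position `π⁻¹(0)`), and
`p(𝐣) ∈ S_n` is obtained from `π` by removing the assignment `q+1 ↦ 1`. -/
theorem szczarba_stmt17 (n : ℕ) (i : SzIndex (n + 1))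
    (π : Equiv.Perm (Fin (n + 1))) (hπ : π = pMap (n + 1) i) :
    (Phi n i 0).2 = (π.symm 0 : ℕ) ∧
    IsRemoval π (π.symm 0) (pMap n (Phi n i 0).1) := by
  subst hπ
  obtain ⟨q, h1, h2, h3⟩ := Phi_zero_spec n i
  rw [← h2, Equiv.symm_apply_apply]
  exact ⟨h1, h3⟩
end
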